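/- arXiv:2006.14616 — 4 statements merged into one kernel-verified Lean document; each statement's English description precedes it below -/
import Mathlib

section
/- Let n be a positive integer and let M be a real n×n matrix with singular value decomposition M = U Σ Vᵀ, where U and V are orthogonal n×n matrices and Σ = diag(s₁, …, sₙ) with s₁ ≥ s₂ ≥ … ≥ sₙ ≥ 0. Let Σ' = diag(1, …, 1, det(U Vᵀ)). Then for every R in the special orthogonal group SO(n), ‖U Σ' Vᵀ − M‖_F ≤ ‖R − M‖_F; that is, U Σ' Vᵀ minimizes the Frobenius distance to M over SO(n). -/
open Matrix

/-- The Frobenius norm of a real square matrix. -/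
noncomputable def frobNorm {n : ℕ} (M : Matrix (Fin n) (Fin n) ℝ) : ℝ :=
  Real.sqrt (∑ i, ∑ j, (M i j) ^ 2)

lemma diag_le_one_of_orthogonal {n : ℕ} {Q : Matrix (Fin n) (Fin n) ℝ} (hQ : Qᵀ * Q = 1)
    (i : Fin n) : Q i i ≤ 1 := by
  have h : ∑ k, Q k i * Q k i = 1 := by
    simpa [Matrix.mul_apply] using congrFun (congrFun hQ i) i
  have h' : Q i i * Q i i ≤ ∑ k, Q k i * Q k i :=
    Finset.single_le_sum (f := fun k => Q k i * Q k i) (fun k _ => mul_self_nonneg _)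
      (Finset.mem_univ i)
  nlinarith

lemma trace_le_of_orthogonal {n : ℕ} {Q : Matrix (Fin n) (Fin n) ℝ} (hQ : Qᵀ * Q = 1) :
    Q.trace ≤ n := by
  simpa [Matrix.trace] using
    Finset.sum_le_sum (s := Finset.univ) fun i _ => diag_le_one_of_orthogonal hQ i

lemma exists_mulVec_eq_neg_of_orthogonal {n : ℕ} {Q : Matrix (Fin n) (Fin n) ℝ}
    (hQ : Qᵀ * Q = 1) (hdet : Q.det = -1) : ∃ v, v ≠ 0 ∧ Q *ᵥ v = -v := by
  have h : (Q + 1).det = 0 := by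
    have h₁ : Qᵀ * (Q + 1) = (Q + 1)ᵀ := by
      rw [mul_add, hQ, mul_one, transpose_add, transpose_one, add_comm]
    have h₂ := congrArg Matrix.det h₁
    rw [det_mul, det_transpose, det_transpose, hdet] at h₂
    linarith
  obtain ⟨v, hv, hker⟩ := Matrix.exists_mulVec_eq_zero_iff.mpr h
  refine ⟨v, hv, ?_⟩
  rw [add_mulVec, one_mulVec] at hker
  exact eq_neg_of_add_eq_zero_left hker

/-- Composing with the reflection in an eigenvector for `-1` raises the trace by `2`. -/
lemma trace_add_two_le_of_orthogonal {n : ℕ} {Q : Matrix (Fin n) (Fin n) ℝ}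
    (hQ : Qᵀ * Q = 1) (hdet : Q.det = -1) : Q.trace + 2 ≤ n := by
  obtain ⟨v, hv, hQv⟩ := exists_mulVec_eq_neg_of_orthogonal hQ hdet
  have hvv : v ⬝ᵥ v ≠ 0 := fun h => hv (dotProduct_self_eq_zero.mp h)
  have hQv' : Qᵀ *ᵥ v = -v := by
    have h : Qᵀ *ᵥ (Q *ᵥ v) = v := by rw [mulVec_mulVec, hQ, one_mulVec]
    rw [hQv, mulVec_neg] at h
    rw [← h, neg_neg, h]
  set c : ℝ := 2 / (v ⬝ᵥ v)
  have hcv : c * (v ⬝ᵥ v) = 2 := div_mul_cancel₀ _ hvv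
  have hP : (Q + c • vecMulVec v v)ᵀ * (Q + c • vecMulVec v v) = 1 := by
    have h₁ : vecMulVec v v * Q = -vecMulVec v v := by
      rw [vecMulVec_mul, ← mulVec_transpose, hQv', vecMulVec_neg]
    have h₂ : Qᵀ * vecMulVec v v = -vecMulVec v v := by
      rw [mul_vecMulVec, hQv', neg_vecMulVec]
    have h₃ : vecMulVec v v * vecMulVec v v = (v ⬝ᵥ v) • vecMulVec v v := by
      rw [vecMulVec_mul_vecMulVec, vecMulVec_smul]
    rw [transpose_add, transpose_smul, transpose_vecMulVec, add_mul, mul_add, mul_add, hQ,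
      smul_mul_assoc, mul_smul_comm, smul_mul_assoc, mul_smul_comm, h₁, h₂, h₃,
      smul_smul c (v ⬝ᵥ v), hcv]
    module
  have h := trace_le_of_orthogonal hP
  rwa [trace_add, trace_smul, trace_vecMulVec, smul_eq_mul, hcv] at h

lemma sum_sq_eq_trace {n : ℕ} (A : Matrix (Fin n) (Fin n) ℝ) :
    ∑ i, ∑ j, (A i j) ^ 2 = (Aᵀ * A).trace := by
  rw [Finset.sum_comm]
  simp [Matrix.trace, Matrix.mul_apply, sq]

lemma sum_sq_sub_eq {n : ℕ} {A : Matrix (Fin n) (Fin n) ℝ} (hA : Aᵀ * A = 1)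
    (U V : Matrix (Fin n) (Fin n) ℝ) (d : Fin n → ℝ) :
    ∑ i, ∑ j, ((A - U * diagonal d * Vᵀ) i j) ^ 2 =
      n - 2 * ∑ i, d i * (Uᵀ * A * V) i i +
        ((U * diagonal d * Vᵀ)ᵀ * (U * diagonal d * Vᵀ)).trace := by
  have h₁ : ((U * diagonal d * Vᵀ)ᵀ * A).trace = ∑ i, d i * (Uᵀ * A * V) i i := by
    have : (U * diagonal d * Vᵀ)ᵀ * A = V * (diagonal d * (Uᵀ * A)) := by
      simp [transpose_mul, Matrix.mul_assoc]
    rw [this, trace_mul_comm, Matrix.mul_assoc]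
    simp [Matrix.trace, diagonal_mul]
  have h₂ : (Aᵀ * (U * diagonal d * Vᵀ)).trace = ∑ i, d i * (Uᵀ * A * V) i i := by
    rw [← h₁, ← trace_transpose, transpose_mul, transpose_transpose]
  rw [sum_sq_eq_trace, transpose_sub, sub_mul, mul_sub, mul_sub, hA]
  simp only [trace_sub, h₁, h₂, trace_one, Fintype.card_fin]
  ring

lemma sum_mul_diag_le {n : ℕ} {Q : Matrix (Fin n) (Fin n) ℝ} (hQ : Qᵀ * Q = 1)
    {d : Fin n → ℝ} (hd : ∀ i, 0 ≤ d i) (l : Fin n) (hl : ∀ i, d l ≤ d i) :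
    ∑ i, d i * Q i i ≤ ∑ i, d i * (if i = l then Q.det else 1) := by
  have hdet : Q.det * Q.det = 1 := by
    simpa using congrArg Matrix.det hQ
  rcases mul_self_eq_one_iff.mp hdet with h | h
  · simp only [h, ite_self]
    exact Finset.sum_le_sum fun i _ =>
      mul_le_mul_of_nonneg_left (diag_le_one_of_orthogonal hQ i) (hd i)
  · have h₁ : ∑ i, (d i - d l) * Q i i ≤ ∑ i, (d i - d l) :=
      Finset.sum_le_sum fun i _ => mul_le_of_le_one_right (sub_nonneg.mpr (hl i))
        (diag_le_one_of_orthogonal hQ i)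
    have h₂ := mul_le_mul_of_nonneg_left (trace_add_two_le_of_orthogonal hQ h) (hd l)
    have h₃ : ∑ i, d i * (if i = l then Q.det else 1) = ∑ i, d i - 2 * d l := by
      have : ∀ i, d i * (if i = l then Q.det else 1) = d i - if i = l then 2 * d l else 0 := by
        intro i
        split_ifs with hi
        · rw [h, hi]; ring
        · ring
      simp [this]
    simp only [sub_mul, Finset.sum_sub_distrib, ← Finset.mul_sum, Finset.sum_const,
      Finset.card_univ, Fintype.card_fin, nsmul_eq_mul] at h₁
    rw [h₃]
    simp only [Matrix.trace, diag_apply] at h₂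
    linarith

/-- **Least-squares optimality of special symmetric orthogonalization
(`SVDO⁺`).** If `M = U Σ Vᵀ` with `U, V` orthogonal and
`Σ = diag(s₁, …, sₙ)`, `s₁ ≥ … ≥ sₙ ≥ 0`, and
`Σ' = diag(1, …, 1, det (U Vᵀ))`, then `U Σ' Vᵀ` minimizes the Frobenius
distance to `M` over the special orthogonal group `SO(n)`. -/
theorem special_svd_orthogonalization_minimizes (n : ℕ) (hn : 0 < n)
    (M U V : Matrix (Fin n) (Fin n) ℝ) (d : Fin n → ℝ)
    (hd_nonneg : ∀ i, 0 ≤ d i)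
    (hd_sorted : ∀ i j : Fin n, i ≤ j → d j ≤ d i)
    (hU : Uᵀ * U = 1) (hV : Vᵀ * V = 1)
    (hM : M = U * Matrix.diagonal d * Vᵀ) :
    ∀ R : Matrix (Fin n) (Fin n) ℝ, Rᵀ * R = 1 → R.det = 1 →
      frobNorm
          (U * Matrix.diagonal
              (fun i : Fin n => if (i : ℕ) = n - 1 then (U * Vᵀ).det else 1) * Vᵀ
            - M)
        ≤ frobNorm (R - M) := by
  intro R hR hRdet
  have hU' : U * Uᵀ = 1 := mul_eq_one_comm.mp hU
  have hV' : V * Vᵀ = 1 := mul_eq_one_comm.mp hV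
  have hW : (U * Vᵀ).det * (U * Vᵀ).det = 1 := by
    have hUdet : U.det * U.det = 1 := by simpa using congrArg Matrix.det hU
    have hVdet : V.det * V.det = 1 := by simpa using congrArg Matrix.det hV
    rw [det_mul, det_transpose, mul_mul_mul_comm, hUdet, hVdet, one_mul]
  have hQ : (Uᵀ * R * V)ᵀ * (Uᵀ * R * V) = 1 := by
    calc (Uᵀ * R * V)ᵀ * (Uᵀ * R * V) = Vᵀ * (Rᵀ * (U * Uᵀ) * R) * V := by
          simp [transpose_mul, Matrix.mul_assoc]
      _ = 1 := by rw [hU', mul_one, hR, mul_one, hV]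
  have hQdet : (Uᵀ * R * V).det = (U * Vᵀ).det := by
    simp [det_mul, hRdet]
  set e : Fin n → ℝ := fun i => if (i : ℕ) = n - 1 then (U * Vᵀ).det else 1 with he
  have hee : diagonal e * diagonal e = 1 := by
    rw [diagonal_mul_diagonal, ← diagonal_one]
    congr 1
    funext i
    simp only [he]
    split_ifs
    · exact hW
    · exact one_mul 1
  have hA : (U * diagonal e * Vᵀ)ᵀ * (U * diagonal e * Vᵀ) = 1 := by
    calc (U * diagonal e * Vᵀ)ᵀ * (U * diagonal e * Vᵀ)
        = V * (diagonal e * (Uᵀ * U) * diagonal e) * Vᵀ := by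
          simp [transpose_mul, Matrix.mul_assoc]
      _ = 1 := by rw [hU, mul_one, hee, mul_one, hV']
  have hUAV : Uᵀ * (U * diagonal e * Vᵀ) * V = diagonal e := by
    calc Uᵀ * (U * diagonal e * Vᵀ) * V = (Uᵀ * U) * diagonal e * (Vᵀ * V) := by
          simp only [Matrix.mul_assoc]
      _ = diagonal e := by rw [hU, hV, one_mul, mul_one]
  let l : Fin n := ⟨n - 1, by omega⟩
  have hkey := sum_mul_diag_le hQ hd_nonneg l fun i =>
    hd_sorted i l (Fin.le_def.mpr (by simp only [l]; omega))
  have hel : ∀ i, (if i = l then (U * Vᵀ).det else 1) = e i := fun i => by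
    simp only [he, l, Fin.ext_iff]
  simp only [hQdet, hel] at hkey
  rw [hM, frobNorm, frobNorm]
  apply Real.sqrt_le_sqrt
  rw [sum_sq_sub_eq hA, sum_sq_sub_eq hR, hUAV]
  simp only [diagonal_apply_eq]
  linarith
end

section
/- Let n be a positive integer. There exist constants C > 0 and δ > 0 such that for every real n×n matrix N with ‖N‖_F ≤ 1 and every σ with 0 < δ and σ < δ, there exist matrices Q and R with Q orthogonal, R upper triangular with strictly positive diagonal entries, I + σN = Q·R, and ‖Q − (I + σ·(L − Lᵀ))‖_F ≤ C·σ², where L denotes the strictly lower-triangular part of N. That is, the orthogonal factor produced by Gram–Schmidt orthogonalization of I + σN equals I + σ(L − Lᵀ) + O(σ²). -/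
open Matrix

section QRPerturbation

open InnerProductSpace
open scoped Matrix.Norms.Frobenius

variable {n : ℕ}

lemma frobNorm_eq_norm (M : Matrix (Fin n) (Fin n) ℝ) : frobNorm M = ‖M‖ := by
  simp [frobNorm, frobenius_norm_def, Real.sqrt_eq_rpow]

lemma abs_apply_le_frobenius_norm (M : Matrix (Fin n) (Fin n) ℝ) (i j : Fin n) :
    |M i j| ≤ ‖M‖ := by
  rw [← frobNorm_eq_norm]
  refine Real.abs_le_sqrt ?_
  calc M i j ^ 2 ≤ ∑ j, M i j ^ 2 :=
        Finset.single_le_sum (f := fun j => M i j ^ 2) (fun _ _ => sq_nonneg _) (Finset.mem_univ j)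
    _ ≤ ∑ i, ∑ j, M i j ^ 2 :=
        Finset.single_le_sum (f := fun i => ∑ j, M i j ^ 2)
          (fun _ _ => Finset.sum_nonneg fun _ _ => sq_nonneg _) (Finset.mem_univ i)

lemma frobenius_norm_le_of_abs_apply_le {M : Matrix (Fin n) (Fin n) ℝ} {b : ℝ} (hb : 0 ≤ b)
    (h : ∀ i j, |M i j| ≤ b) : ‖M‖ ≤ n * b := by
  rw [← frobNorm_eq_norm]
  refine Real.sqrt_le_iff.2 ⟨by positivity, ?_⟩
  calc ∑ i, ∑ j, M i j ^ 2 ≤ ∑ _i : Fin n, ∑ _j : Fin n, b ^ 2 :=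
        Finset.sum_le_sum fun i _ => Finset.sum_le_sum fun j _ => sq_le_sq' (abs_le.1 (h i j)).1
          (abs_le.1 (h i j)).2
    _ = (n * b) ^ 2 := by simp; ring

/-- Existence of the QR decomposition of an invertible matrix. -/
lemma exists_qr_of_isUnit {A : Matrix (Fin n) (Fin n) ℝ} (hA : IsUnit A) :
    ∃ Q R : Matrix (Fin n) (Fin n) ℝ, Qᵀ * Q = 1 ∧ (∀ i j, j < i → R i j = 0) ∧
      (∀ i, 0 < R i i) ∧ A = Q * R := by
  let f : Fin n → EuclideanSpace ℝ (Fin n) := fun j => WithLp.toLp 2 (A.col j)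
  have hf : LinearIndependent ℝ f :=
    (linearIndependent_cols_iff_isUnit.2 hA).map'
      (WithLp.linearEquiv 2 ℝ (Fin n → ℝ)).symm.toLinearMap (LinearEquiv.ker _)
  let Q : Matrix (Fin n) (Fin n) ℝ := of fun i j => gramSchmidtNormed ℝ f j i
  have hQ : Qᵀ * Q = 1 := by
    ext i j
    have := orthonormal_iff_ite.1 (gramSchmidtNormed_orthonormal hf) i j
    rw [PiLp.inner_apply] at this
    simpa [Q, mul_apply, one_apply, mul_comm] using this
  have hR (i j : Fin n) :
      (Qᵀ * A) i j = ‖gramSchmidt ℝ f i‖⁻¹ * inner ℝ (gramSchmidt ℝ f i) (f j) := by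
    rw [PiLp.inner_apply, Finset.mul_sum]
    simp [Q, f, mul_apply, gramSchmidtNormed, mul_comm, mul_assoc]
  refine ⟨Q, Qᵀ * A, hQ, fun i j hij => ?_, fun i => ?_, ?_⟩
  · rw [hR, gramSchmidt_inv_triangular ℝ f hij, mul_zero]
  · have h0 : 0 < ‖gramSchmidt ℝ f i‖ := norm_pos_iff.2 (gramSchmidt_ne_zero i hf)
    have : inner ℝ (gramSchmidt ℝ f i) (f i) = ‖gramSchmidt ℝ f i‖ ^ 2 := by
      rw [gramSchmidt_def'' ℝ f i, inner_add_right, inner_sum, real_inner_self_eq_norm_sq,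
        Finset.sum_eq_zero, add_zero]
      intro k hk
      rw [inner_smul_right, gramSchmidt_orthogonal ℝ f (Finset.mem_Iio.1 hk).ne', mul_zero]
    rw [hR, this]
    positivity
  · rw [← Matrix.mul_assoc, mul_eq_one_comm.1 hQ, Matrix.one_mul]

lemma sum_col_sq_of_transpose_mul_self {Q : Matrix (Fin n) (Fin n) ℝ} (hQ : Qᵀ * Q = 1)
    (j : Fin n) : ∑ k, Q k j ^ 2 = 1 := by
  have := congrFun (congrFun hQ j) j
  simpa [mul_apply, sq] using this

lemma frobenius_norm_le_of_transpose_mul_self {Q : Matrix (Fin n) (Fin n) ℝ} (hQ : Qᵀ * Q = 1) :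
    ‖Q‖ ≤ n := by
  have h (i j : Fin n) : |Q i j| ≤ 1 := by
    refine (sq_le_one_iff_abs_le_one _).1 ?_
    rw [← sum_col_sq_of_transpose_mul_self hQ j]
    exact Finset.single_le_sum (f := fun k => Q k j ^ 2) (fun _ _ => sq_nonneg _)
      (Finset.mem_univ i)
  simpa using frobenius_norm_le_of_abs_apply_le zero_le_one h

/-- The orthogonal factor of a small perturbation `1 + M` of the identity has small
off-diagonal entries. -/
lemma abs_offDiag_orthogonal_factor_le {M Q R : Matrix (Fin n) (Fin n) ℝ} {σ : ℝ}
    (hM : ‖M‖ ≤ σ) (hσ : σ ≤ 1 / 2) (hQ : Qᵀ * Q = 1) (hR : ∀ i j, j < i → R i j = 0)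
    (hRpos : ∀ i, 0 < R i i) (h : 1 + M = Q * R) {i j : Fin n} (hij : i ≠ j) :
    |Q i j| ≤ 2 * n * σ := by
  have hσ0 : 0 ≤ σ := (norm_nonneg M).trans hM
  have hQn := frobenius_norm_le_of_transpose_mul_self hQ
  rcases hij.lt_or_gt with hij | hij
  · have hRQ : R = Qᵀ + Qᵀ * M := by
      rw [← mul_one_add, h, ← Matrix.mul_assoc, hQ, Matrix.one_mul]
    have hzero : 0 = Q i j + (Qᵀ * M) j i := by
      rw [← hR j i hij]
      exact congrFun (congrFun hRQ j) i
    calc |Q i j| = |(Qᵀ * M) j i| := by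
          rw [eq_neg_of_add_eq_zero_left hzero.symm, abs_neg]
      _ ≤ ‖Qᵀ * M‖ := abs_apply_le_frobenius_norm _ _ _
      _ ≤ ‖Qᵀ‖ * ‖M‖ := frobenius_norm_mul _ _
      _ ≤ n * σ := by rw [frobenius_norm_transpose]; gcongr
      _ ≤ 2 * n * σ := by nlinarith [mul_nonneg (Nat.cast_nonneg (α := ℝ) n) hσ0]
  · have hRtri : R.IsUpperTriangular := fun i j hij => hR i j hij
    have hdet : IsUnit R.det := by
      rw [det_of_isUpperTriangular hRtri]
      exact (Finset.prod_pos fun i _ => hRpos i).ne'.isUnit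
    have : Invertible R := R.invertibleOfIsUnitDet hdet
    have hinv : R⁻¹ i j = 0 := blockTriangular_inv_of_blockTriangular hRtri hij
    have hQR : Q = R⁻¹ + M * R⁻¹ := by
      rw [← one_add_mul, h, Matrix.mul_assoc, mul_nonsing_inv _ hdet, Matrix.mul_one]
    have hle : ‖M * R⁻¹‖ ≤ σ * ‖R⁻¹‖ :=
      (frobenius_norm_mul _ _).trans (by gcongr)
    have hinvn : ‖R⁻¹‖ ≤ 2 * n := by
      have h1 : R⁻¹ = Q - M * R⁻¹ := eq_sub_of_add_eq hQR.symm
      have h2 : ‖R⁻¹‖ ≤ ‖Q‖ + ‖M * R⁻¹‖ := by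
        conv_lhs => rw [h1]
        exact norm_sub_le _ _
      nlinarith [norm_nonneg R⁻¹]
    calc |Q i j| = |(M * R⁻¹) i j| := by
          conv_lhs => rw [hQR, Matrix.add_apply, hinv, zero_add]
      _ ≤ ‖M * R⁻¹‖ := abs_apply_le_frobenius_norm _ _ _
      _ ≤ σ * (2 * n) := hle.trans (by gcongr)
      _ = 2 * n * σ := by ring

/-- The diagonal of the orthogonal factor of `1 + M` agrees with that of the identity up to
second order. -/
lemma abs_diag_orthogonal_factor_sub_one_le {M Q R : Matrix (Fin n) (Fin n) ℝ} {σ : ℝ}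
    (hM : ‖M‖ ≤ σ) (hσ : σ ≤ 1 / 2) (hσn : n * σ ≤ 1 / 2) (hQ : Qᵀ * Q = 1)
    (hR : ∀ i j, j < i → R i j = 0) (hRpos : ∀ i, 0 < R i i) (h : 1 + M = Q * R) (i : Fin n) :
    |Q i i - 1| ≤ 8 * n ^ 3 * σ ^ 2 := by
  have hσ0 : 0 ≤ σ := (norm_nonneg M).trans hM
  have hQn := frobenius_norm_le_of_transpose_mul_self hQ
  have hlower : -(1 / 2) ≤ Q i i := by
    have hRQ : R = Qᵀ + Qᵀ * M := by
      rw [← mul_one_add, h, ← Matrix.mul_assoc, hQ, Matrix.one_mul]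
    have hpos : 0 < Q i i + (Qᵀ * M) i i := by
      have := hRpos i
      rwa [hRQ] at this
    have hle : |(Qᵀ * M) i i| ≤ n * σ := by
      refine (abs_apply_le_frobenius_norm _ _ _).trans ((frobenius_norm_mul _ _).trans ?_)
      rw [frobenius_norm_transpose]
      gcongr
    linarith [(abs_le.1 hle).2]
  have hsum : 1 - Q i i ^ 2 = ∑ k ∈ Finset.univ.erase i, Q k i ^ 2 := by
    rw [← sum_col_sq_of_transpose_mul_self hQ i,
      ← Finset.add_sum_erase _ (fun k => Q k i ^ 2) (Finset.mem_univ i)]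
    ring
  have hsum0 : 0 ≤ 1 - Q i i ^ 2 := hsum ▸ Finset.sum_nonneg fun _ _ => sq_nonneg _
  have hsumle : 1 - Q i i ^ 2 ≤ n * (2 * n * σ) ^ 2 := by
    rw [hsum]
    calc ∑ k ∈ Finset.univ.erase i, Q k i ^ 2
        ≤ ∑ _k ∈ Finset.univ.erase i, (2 * n * σ) ^ 2 :=
          Finset.sum_le_sum fun k hk => by
            have := abs_offDiag_orthogonal_factor_le hM hσ hQ hR hRpos h (Finset.ne_of_mem_erase hk)
            exact sq_le_sq' (abs_le.1 this).1 (abs_le.1 this).2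
      _ ≤ ∑ _k : Fin n, (2 * n * σ) ^ 2 :=
          Finset.sum_le_sum_of_subset_of_nonneg (Finset.erase_subset _ _)
            fun _ _ _ => sq_nonneg _
      _ = n * (2 * n * σ) ^ 2 := by simp
  have hle1 : Q i i ≤ 1 := by nlinarith
  rw [abs_of_nonpos (by linarith)]
  nlinarith

/-- The orthogonal factor of `1 + M` agrees with the identity up to first order. -/
lemma frobenius_norm_orthogonal_factor_sub_one_le {M Q R : Matrix (Fin n) (Fin n) ℝ} {σ : ℝ}
    (hM : ‖M‖ ≤ σ) (hσ : σ ≤ 1 / 2) (hσn : n * σ ≤ 1 / 2) (hQ : Qᵀ * Q = 1)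
    (hR : ∀ i j, j < i → R i j = 0) (hRpos : ∀ i, 0 < R i i) (h : 1 + M = Q * R) :
    ‖Q - 1‖ ≤ 8 * n ^ 4 * σ := by
  have hσ0 : 0 ≤ σ := (norm_nonneg M).trans hM
  have hent (i j : Fin n) : |(Q - 1) i j| ≤ 8 * n ^ 3 * σ := by
    have hn : (1 : ℝ) ≤ n := by exact_mod_cast i.pos
    rcases eq_or_ne i j with rfl | hij
    · have := abs_diag_orthogonal_factor_sub_one_le hM hσ hσn hQ hR hRpos h i
      rw [Matrix.sub_apply, one_apply_eq]
      refine this.trans ?_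
      gcongr
      nlinarith
    · rw [Matrix.sub_apply, one_apply_ne hij, sub_zero]
      refine (abs_offDiag_orthogonal_factor_le hM hσ hQ hR hRpos h hij).trans ?_
      gcongr
      · norm_num
      · exact le_self_pow₀ hn (by norm_num)
  refine (frobenius_norm_le_of_abs_apply_le (by positivity) hent).trans_eq (by ring)

/-- Entrywise second-order expansion of the orthogonal factor of `1 + M`. -/
lemma abs_orthogonal_factor_sub_expansion_le {M Q R : Matrix (Fin n) (Fin n) ℝ} {σ : ℝ}
    (hM : ‖M‖ ≤ σ) (hσ : σ ≤ 1 / 2) (hσn : n * σ ≤ 1 / 2) (hQ : Qᵀ * Q = 1)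
    (hR : ∀ i j, j < i → R i j = 0) (hRpos : ∀ i, 0 < R i i) (h : 1 + M = Q * R)
    (i j : Fin n) :
    |Q i j - ((1 : Matrix (Fin n) (Fin n) ℝ) i j +
      ((if j < i then M i j else 0) - if i < j then M j i else 0))| ≤ 80 * n ^ 8 * σ ^ 2 := by
  have hσ0 : 0 ≤ σ := (norm_nonneg M).trans hM
  have hn : (1 : ℝ) ≤ n := by exact_mod_cast i.pos
  have hK := frobenius_norm_orthogonal_factor_sub_one_le hM hσ hσn hQ hR hRpos h
  obtain ⟨K, hQK⟩ : ∃ K : Matrix (Fin n) (Fin n) ℝ, K = Q - 1 := ⟨_, rfl⟩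
  rw [← hQK] at hK
  have hpow4 : (n : ℝ) ^ 4 ≤ n ^ 8 := pow_le_pow_right₀ hn (by norm_num)
  have hupper (i j : Fin n) (hij : i < j) : |Q i j + M j i| ≤ 8 * n ^ 4 * σ ^ 2 := by
    have hRQ : R = Qᵀ + M + Kᵀ * M := by
      rw [hQK, transpose_sub, transpose_one, Matrix.sub_mul, Matrix.one_mul, add_assoc,
        add_sub_cancel, ← mul_one_add, h, ← Matrix.mul_assoc, hQ, Matrix.one_mul]
    have hzero : 0 = Q i j + M j i + (Kᵀ * M) j i := by
      rw [← hR j i hij]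
      exact congrFun (congrFun hRQ j) i
    calc |Q i j + M j i| = |(Kᵀ * M) j i| := by
          rw [eq_neg_of_add_eq_zero_left hzero.symm, abs_neg]
      _ ≤ ‖Kᵀ‖ * ‖M‖ :=
          (abs_apply_le_frobenius_norm _ _ _).trans (frobenius_norm_mul _ _)
      _ ≤ 8 * n ^ 4 * σ * σ := by rw [frobenius_norm_transpose]; gcongr
      _ = 8 * n ^ 4 * σ ^ 2 := by ring
  rcases lt_trichotomy i j with hij | rfl | hij
  · rw [one_apply_ne hij.ne, if_neg hij.not_gt, if_pos hij, zero_add, zero_sub, sub_neg_eq_add]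
    refine (hupper i j hij).trans ?_
    gcongr
    norm_num
  · simp only [one_apply_eq, lt_irrefl, if_false, sub_zero, add_zero]
    refine (abs_diag_orthogonal_factor_sub_one_le hM hσ hσn hQ hR hRpos h i).trans ?_
    gcongr <;> norm_num
  · rw [one_apply_ne hij.ne', if_pos hij, if_neg hij.not_gt, zero_add, sub_zero]
    have hKK : Kᵀ * K = 1 + 1 - Q - Qᵀ := by
      rw [hQK, transpose_sub, transpose_one, Matrix.sub_mul, Matrix.mul_sub, hQ]
      simp only [Matrix.mul_one, Matrix.one_mul]
      abel
    have hent : (Kᵀ * K) i j = - Q i j - Q j i := by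
      rw [hKK]
      simp [one_apply_ne hij.ne']
    have hle : |(Kᵀ * K) i j| ≤ 64 * n ^ 8 * σ ^ 2 := by
      calc _ ≤ ‖Kᵀ‖ * ‖K‖ :=
            (abs_apply_le_frobenius_norm _ _ _).trans (frobenius_norm_mul _ _)
        _ ≤ (8 * n ^ 4 * σ) * (8 * n ^ 4 * σ) := by rw [frobenius_norm_transpose]; gcongr
        _ = 64 * n ^ 8 * σ ^ 2 := by ring
    have heq : Q i j - M i j = -((Q j i + M i j) + (Kᵀ * K) i j) := by
      rw [hent]; ring
    rw [heq, abs_neg]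
    refine (abs_add_le _ _).trans ((add_le_add (hupper j i hij) hle).trans ?_)
    nlinarith [mul_le_mul_of_nonneg_right hpow4 (sq_nonneg σ),
      mul_nonneg (pow_nonneg (Nat.cast_nonneg (α := ℝ) n) 8) (sq_nonneg σ)]

lemma isUnit_one_add_of_frobenius_norm_lt_one {M : Matrix (Fin n) (Fin n) ℝ} (hM : ‖M‖ < 1) :
    IsUnit (1 + M) := by
  have : CompleteSpace (Matrix (Fin n) (Fin n) ℝ) := FiniteDimensional.complete ℝ _
  rw [← sub_neg_eq_add]
  exact isUnit_one_sub_of_norm_lt_one (by rwa [norm_neg])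

lemma norm_smul_le_of_frobNorm_le_one {N : Matrix (Fin n) (Fin n) ℝ} (hN : frobNorm N ≤ 1)
    {σ : ℝ} (hσ : 0 ≤ σ) : ‖σ • N‖ ≤ σ := by
  rw [norm_smul, Real.norm_of_nonneg hσ, ← frobNorm_eq_norm]
  exact mul_le_of_le_one_right hσ hN

end QRPerturbation

/-- **First-order expansion of Gram–Schmidt orthogonalization.** There are
`C > 0` and `δ > 0` such that for every `N` with `‖N‖_F ≤ 1` and every
`0 < σ < δ`, the matrix `I + σN` has a QR decomposition `Q·R` (`Q` orthogonal,
`R` upper triangular with strictly positive diagonal) with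
`‖Q − (I + σ(L − Lᵀ))‖_F ≤ C σ²`, where `L` is the strictly lower-triangular
part of `N`; i.e. `GS(I + σN) = I + σ(L − Lᵀ) + O(σ²)`. -/
theorem gram_schmidt_orthogonalization_first_order (n : ℕ) (hn : 0 < n) :
    ∃ C > (0 : ℝ), ∃ δ > (0 : ℝ),
      ∀ N : Matrix (Fin n) (Fin n) ℝ, frobNorm N ≤ 1 →
        ∀ σ : ℝ, 0 < σ → σ < δ →
          ∃ Q R : Matrix (Fin n) (Fin n) ℝ,
            Qᵀ * Q = 1 ∧
            (∀ i j : Fin n, j < i → R i j = 0) ∧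
            (∀ i : Fin n, 0 < R i i) ∧
            (1 : Matrix (Fin n) (Fin n) ℝ) + σ • N = Q * R ∧
            frobNorm (Q - (1 + σ •
                ((Matrix.of fun i j : Fin n => if j < i then N i j else 0) -
                 (Matrix.of fun i j : Fin n => if j < i then N i j else 0)ᵀ)))
              ≤ C * σ ^ 2 := by
  have hn1 : (1 : ℝ) ≤ n := by exact_mod_cast hn
  refine ⟨n * (80 * n ^ 8), by positivity, 1 / (2 * n), by positivity, fun N hN σ hσ0 hσ => ?_⟩
  have hσn : n * σ ≤ 1 / 2 := by
    rw [lt_div_iff₀ (by positivity)] at hσ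
    linarith
  have hσ2 : σ ≤ 1 / 2 := by nlinarith
  have hM := norm_smul_le_of_frobNorm_le_one hN hσ0.le
  obtain ⟨Q, R, hQ, hR, hRpos, h⟩ :=
    exists_qr_of_isUnit (isUnit_one_add_of_frobenius_norm_lt_one (by linarith : _ < (1 : ℝ)))
  refine ⟨Q, R, hQ, hR, hRpos, h, ?_⟩
  rw [frobNorm_eq_norm, mul_assoc]
  refine frobenius_norm_le_of_abs_apply_le (by positivity) fun i j => ?_
  convert abs_orthogonal_factor_sub_expansion_le hM hσ2 hσn hQ hR hRpos h i j using 2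
  simp [mul_sub]
end

section
/- Let n be a positive integer. There exists a function f from real n×n matrices to real n×n matrices which is infinitely differentiable (C^∞) on the open set {M : det(M) ≠ 0}, and such that for every M with det(M) ≠ 0, f(M) is an orthogonal matrix and ‖f(M) − M‖_F ≤ ‖R − M‖_F for every orthogonal matrix R. That is, the symmetric orthogonalization SVDO(M), the Frobenius-nearest orthogonal matrix to M, is a smooth function of M on the set of invertible matrices. -/
open Matrix

open scoped Matrix.Norms.Frobenius MatrixOrder Topology

namespace Matrix

variable {m : Type*} [Fintype m]

lemma frobenius_norm_sq_eq_trace (X : Matrix m m ℝ) : ‖X‖ ^ 2 = (Xᵀ * X).trace := by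
  rw [frobenius_norm_def, ← Real.sqrt_eq_rpow, Real.sq_sqrt (by positivity), trace,
    Finset.sum_comm]
  simp [mul_apply, sq]

lemma trace_transpose_mul_mul_nonneg {P : Matrix m m ℝ} (hP : P.PosSemidef)
    (X : Matrix m m ℝ) : 0 ≤ (Xᵀ * P * X).trace := by
  simpa using (hP.conjTranspose_mul_mul_same X).trace_nonneg

lemma trace_transpose_mul_le_norm_mul_norm (X Y : Matrix m m ℝ) :
    (Xᵀ * Y).trace ≤ ‖X‖ * ‖Y‖ := by
  have hnorm (Z : Matrix m m ℝ) : ‖Z‖ = √(∑ p : m × m, Z p.1 p.2 ^ 2) := by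
    rw [frobenius_norm_def, ← Real.sqrt_eq_rpow, Fintype.sum_prod_type]
    simp
  have htrace : (Xᵀ * Y).trace = ∑ p : m × m, X p.1 p.2 * Y p.1 p.2 := by
    rw [Fintype.sum_prod_type, Finset.sum_comm]
    simp [trace, mul_apply]
  rw [hnorm, hnorm, htrace]
  exact Real.sum_mul_le_sqrt_mul_sqrt _ _ _

lemma posSemidef_transpose_mul_self_real (M : Matrix m m ℝ) : (Mᵀ * M).PosSemidef := by
  simpa using posSemidef_conjTranspose_mul_self M

variable [DecidableEq m]

lemma posSemidef_sqrt (A : Matrix m m ℝ) : (CFC.sqrt A).PosSemidef :=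
  nonneg_iff_posSemidef.mp (CFC.sqrt_nonneg A)

/-- The quadratic form `X ↦ tr (Xᵀ S X)` of a positive definite `S` is coercive. -/
lemma PosDef.exists_norm_sq_le_trace {S : Matrix m m ℝ} (hS : S.PosDef) :
    ∃ K : ℝ, 0 ≤ K ∧ ∀ X : Matrix m m ℝ, ‖X‖ ^ 2 ≤ K * (Xᵀ * S * X).trace := by
  set Y := CFC.sqrt S
  have hYY : Y * Y = S := CFC.sqrt_mul_sqrt_self S hS.posSemidef.nonneg
  have hYt : Yᵀ = Y := by simpa using (posSemidef_sqrt S).isHermitian.eq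
  have hdet : IsUnit Y.det := by
    have h := hS.det_pos
    rw [← hYY, det_mul] at h
    exact isUnit_iff_ne_zero.mpr fun h0 => by simp [h0] at h
  refine ⟨‖Y⁻¹‖ ^ 2, by positivity, fun X => ?_⟩
  calc ‖X‖ ^ 2 = ‖Y⁻¹ * (Y * X)‖ ^ 2 := by rw [nonsing_inv_mul_cancel_left _ _ hdet]
    _ ≤ (‖Y⁻¹‖ * ‖Y * X‖) ^ 2 := by gcongr; exact norm_mul_le _ _
    _ = ‖Y⁻¹‖ ^ 2 * (Xᵀ * S * X).trace := by
      rw [mul_pow, frobenius_norm_sq_eq_trace (Y * X), transpose_mul, hYt, ← hYY]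
      simp only [Matrix.mul_assoc]

/-- The positive semidefinite square root is Lipschitz around a positive definite matrix. -/
lemma PosDef.exists_norm_sub_le_norm_sq_sub {S : Matrix m m ℝ} (hS : S.PosDef) :
    ∃ K : ℝ, 0 ≤ K ∧ ∀ T : Matrix m m ℝ, T.PosSemidef → ‖T - S‖ ≤ K * ‖T * T - S * S‖ := by
  obtain ⟨K, hK, hKX⟩ := hS.exists_norm_sq_le_trace
  refine ⟨K, hK, fun T hT => ?_⟩
  have hTr : ((T - S)ᵀ * S * (T - S)).trace ≤ ((T - S)ᵀ * (T * T - S * S)).trace := by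
    have h := trace_transpose_mul_mul_nonneg hT (T - S)ᵀ
    have hcyc : ((T - S) * T * (T - S)ᵀ).trace = ((T - S)ᵀ * ((T - S) * T)).trace :=
      trace_mul_comm _ _
    have hsplit : T * T - S * S = S * (T - S) + (T - S) * T := by noncomm_ring
    rw [transpose_transpose, hcyc] at h
    rw [hsplit, mul_add, trace_add, ← Matrix.mul_assoc]
    linarith
  have hmain : ‖T - S‖ * ‖T - S‖ ≤ ‖T - S‖ * (K * ‖T * T - S * S‖) := by
    calc ‖T - S‖ * ‖T - S‖ = ‖T - S‖ ^ 2 := (sq _).symm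
      _ ≤ K * ((T - S)ᵀ * S * (T - S)).trace := hKX _
      _ ≤ K * (‖T - S‖ * ‖T * T - S * S‖) := by
        gcongr
        exact hTr.trans (trace_transpose_mul_le_norm_mul_norm _ _)
      _ = _ := by ring
  rcases (norm_nonneg (T - S)).eq_or_lt with h0 | h0
  · rw [← h0]; positivity
  · exact le_of_mul_le_mul_left hmain h0

/-- The Sylvester operator `X ↦ S X + X S` of a positive definite `S` is injective. -/
lemma PosDef.eq_zero_of_mul_add_mul_eq_zero {S X : Matrix m m ℝ} (hS : S.PosDef)
    (h : S * X + X * S = 0) : X = 0 := by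
  obtain ⟨K, hK, hKX⟩ := hS.exists_norm_sq_le_trace
  have h1 := trace_transpose_mul_mul_nonneg hS.posSemidef Xᵀ
  have h2 : (X * S * Xᵀ).trace = (Xᵀ * (X * S)).trace := trace_mul_comm _ _
  have h3 : (Xᵀ * S * X).trace + (Xᵀ * (X * S)).trace = 0 := by
    rw [← trace_add, Matrix.mul_assoc, ← mul_add, h, mul_zero, trace_zero]
  rw [transpose_transpose, h2] at h1
  have h4 : ‖X‖ ^ 2 ≤ 0 := (hKX X).trans (mul_nonpos_of_nonneg_of_nonpos hK (by linarith))
  exact norm_eq_zero.mp (pow_eq_zero_iff two_ne_zero |>.mp (le_antisymm h4 (sq_nonneg _)))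

/-- Near a positive definite matrix, the square root on positive semidefinite matrices extends
to a smooth function of all matrices. -/
lemma PosDef.exists_contDiffAt_eventually_eq_sqrt {A : Matrix m m ℝ} (hA : A.PosDef) :
    ∃ g : Matrix m m ℝ → Matrix m m ℝ, ContDiffAt ℝ (⊤ : ℕ∞) g A ∧
      ∀ᶠ B in 𝓝 A, B.PosSemidef → g B = CFC.sqrt B := by
  set S := CFC.sqrt A
  have hSS : S * S = A := CFC.sqrt_mul_sqrt_self A hA.posSemidef.nonneg
  have hS : S.PosDef := by
    refine (posSemidef_sqrt A).posDef_iff_isUnit.mpr ?_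
    have hu : IsUnit (S * S) := hSS ▸ hA.isUnit
    exact isUnit_of_mul_isUnit_left hu
  let L : Matrix m m ℝ →ₗ[ℝ] Matrix m m ℝ :=
    LinearMap.mulLeft ℝ S + LinearMap.mulRight ℝ S
  have hL : Function.Injective L := by
    refine (injective_iff_map_eq_zero L).mpr fun X hX => hS.eq_zero_of_mul_add_mul_eq_zero ?_
    simpa [L] using hX
  let e : Matrix m m ℝ ≃L[ℝ] Matrix m m ℝ :=
    (LinearEquiv.ofInjectiveEndo L hL).toContinuousLinearEquiv
  have hcd : ContDiffAt ℝ (⊤ : ℕ∞) (fun X : Matrix m m ℝ => X * X) S :=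
    contDiffAt_id.mul contDiffAt_id
  have hder : HasFDerivAt (fun X : Matrix m m ℝ => X * X)
      (e : Matrix m m ℝ →L[ℝ] Matrix m m ℝ) S := by
    refine ((hasFDerivAt_id S).mul' (hasFDerivAt_id S)).congr_fderiv ?_
    ext1 X
    change S * X + X * S = S * X + X * S
    rfl
  have hne : ((⊤ : ℕ∞) : WithTop ℕ∞) ≠ 0 := by simp
  refine ⟨hcd.localInverse hder hne, hSS ▸ hcd.to_localInverse hder hne, ?_⟩
  have hleft := (hcd.hasStrictFDerivAt' hder hne).eventually_left_inverse
  obtain ⟨ε, hε, hball⟩ := Metric.eventually_nhds_iff.mp hleft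
  obtain ⟨K, hK, hlip⟩ := hS.exists_norm_sub_le_norm_sq_sub
  refine Metric.eventually_nhds_iff.mpr ⟨ε / (K + 1), by positivity, fun B hB hBpos => ?_⟩
  have hTT : CFC.sqrt B * CFC.sqrt B = B := CFC.sqrt_mul_sqrt_self B hBpos.nonneg
  have hclose : dist (CFC.sqrt B) S < ε := by
    have h := hlip (CFC.sqrt B) (posSemidef_sqrt B)
    rw [hTT, hSS, ← dist_eq_norm, ← dist_eq_norm] at h
    rw [lt_div_iff₀ (by positivity)] at hB
    nlinarith [dist_nonneg (x := B) (y := A)]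
  have h := hball hclose
  simp only [hTT] at h
  exact h

/-- The orthogonal polar factor `M (MᵀM)^(-1/2)`. -/
noncomputable def polarFactor (M : Matrix m m ℝ) : Matrix m m ℝ :=
  M * (CFC.sqrt (Mᵀ * M))⁻¹

lemma sqrt_mul_sqrt_transpose_mul_self (M : Matrix m m ℝ) :
    CFC.sqrt (Mᵀ * M) * CFC.sqrt (Mᵀ * M) = Mᵀ * M :=
  CFC.sqrt_mul_sqrt_self _ (posSemidef_transpose_mul_self_real M).nonneg

lemma isUnit_det_sqrt_transpose_mul_self {M : Matrix m m ℝ} (hM : M.det ≠ 0) :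
    IsUnit (CFC.sqrt (Mᵀ * M)).det := by
  refine isUnit_iff_ne_zero.mpr fun h0 => hM ?_
  have h := congrArg det (sqrt_mul_sqrt_transpose_mul_self M)
  rw [det_mul, det_mul, det_transpose, h0, zero_mul] at h
  exact mul_self_eq_zero.mp h.symm

lemma contDiffAt_polarFactor {M : Matrix m m ℝ} (hM : M.det ≠ 0) :
    ContDiffAt ℝ (⊤ : ℕ∞) polarFactor M := by
  have hdet := isUnit_det_sqrt_transpose_mul_self hM
  have hpos : (Mᵀ * M).PosDef := by
    refine (posSemidef_transpose_mul_self_real M).posDef_iff_isUnit.mpr ?_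
    rw [isUnit_iff_isUnit_det, det_mul, det_transpose]
    exact (isUnit_iff_ne_zero.mpr hM).mul (isUnit_iff_ne_zero.mpr hM)
  obtain ⟨g, hg, hgeq⟩ := hpos.exists_contDiffAt_eventually_eq_sqrt
  have hgram : ContDiff ℝ (⊤ : ℕ∞) (fun X : Matrix m m ℝ => Xᵀ * X) :=
    (LinearMap.toContinuousLinearMap
      (transposeLinearEquiv m m ℝ ℝ).toLinearMap).contDiff.mul contDiff_id
  have hgM : g (Mᵀ * M) = CFC.sqrt (Mᵀ * M) := hgeq.self_of_nhds hpos.posSemidef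
  have hroot : ContDiffAt ℝ (⊤ : ℕ∞) (fun X : Matrix m m ℝ => g (Xᵀ * X)) M :=
    ContDiffAt.comp M hg hgram.contDiffAt
  have hunit : IsUnit (g (Mᵀ * M)) := by rwa [hgM, isUnit_iff_isUnit_det]
  obtain ⟨u, hu⟩ := hunit
  have hinv : ContDiffAt ℝ (⊤ : ℕ∞) Ring.inverse (g (Mᵀ * M)) := hu ▸ contDiffAt_ringInverse ℝ u
  have hsmooth : ContDiffAt ℝ (⊤ : ℕ∞)
      (fun X : Matrix m m ℝ => X * Ring.inverse (g (Xᵀ * X))) M :=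
    contDiffAt_id.mul (ContDiffAt.comp (g := Ring.inverse) M hinv hroot)
  refine hsmooth.congr_of_eventuallyEq ?_
  filter_upwards [hgram.continuous.continuousAt.eventually hgeq] with X hX
  rw [polarFactor, hX (posSemidef_transpose_mul_self_real X), nonsing_inv_eq_ringInverse]

lemma polarFactor_mul_sqrt {M : Matrix m m ℝ} (hM : M.det ≠ 0) :
    polarFactor M * CFC.sqrt (Mᵀ * M) = M :=
  nonsing_inv_mul_cancel_right _ _ (isUnit_det_sqrt_transpose_mul_self hM)

lemma polarFactor_transpose_mul_self {M : Matrix m m ℝ} (hM : M.det ≠ 0) :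
    (polarFactor M)ᵀ * polarFactor M = 1 := by
  have hdet := isUnit_det_sqrt_transpose_mul_self hM
  have hsymm : (CFC.sqrt (Mᵀ * M))ᵀ = CFC.sqrt (Mᵀ * M) := by
    simpa using (posSemidef_sqrt (Mᵀ * M)).isHermitian.eq
  rw [polarFactor, transpose_mul, transpose_nonsing_inv, hsymm]
  calc (CFC.sqrt (Mᵀ * M))⁻¹ * Mᵀ * (M * (CFC.sqrt (Mᵀ * M))⁻¹)
      = (CFC.sqrt (Mᵀ * M))⁻¹ * ((Mᵀ * M) * (CFC.sqrt (Mᵀ * M))⁻¹) := by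
        simp only [Matrix.mul_assoc]
    _ = (CFC.sqrt (Mᵀ * M))⁻¹ *
          (CFC.sqrt (Mᵀ * M) * CFC.sqrt (Mᵀ * M) * (CFC.sqrt (Mᵀ * M))⁻¹) := by
        rw [sqrt_mul_sqrt_transpose_mul_self]
    _ = 1 := by rw [mul_nonsing_inv_cancel_right _ _ hdet, nonsing_inv_mul _ hdet]

/-- Among orthogonal `W`, the trace of `W P` with `P` positive semidefinite is largest at `1`. -/
lemma PosSemidef.trace_mul_le_trace {P W : Matrix m m ℝ} (hP : P.PosSemidef)
    (hW : Wᵀ * W = 1) : (W * P).trace ≤ P.trace := by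
  have h := trace_transpose_mul_mul_nonneg hP (1 - W)ᵀ
  have hPt : Pᵀ = P := by simpa using hP.isHermitian.eq
  have h1 : (W * P * Wᵀ).trace = P.trace := by
    rw [trace_mul_comm, ← Matrix.mul_assoc, hW, Matrix.one_mul]
  have h2 : (P * Wᵀ).trace = (W * P).trace := by
    rw [← trace_transpose, transpose_mul, transpose_transpose, hPt]
  have h3 : (1 - W) * P * (1 - W)ᵀ = P - W * P - P * Wᵀ + W * P * Wᵀ := by
    rw [transpose_sub, transpose_one]; noncomm_ring
  rw [transpose_transpose, h3, trace_add, trace_sub, trace_sub, h1, h2] at h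
  linarith

lemma trace_transpose_mul_self_orthogonal_sub {R : Matrix m m ℝ} (hR : Rᵀ * R = 1)
    (M : Matrix m m ℝ) : ((R - M)ᵀ * (R - M)).trace =
      (1 : Matrix m m ℝ).trace - 2 * (Rᵀ * M).trace + (Mᵀ * M).trace := by
  have h1 : (R - M)ᵀ * (R - M) = Rᵀ * R - Rᵀ * M - Mᵀ * R + Mᵀ * M := by
    rw [transpose_sub]; noncomm_ring
  have h2 : (Mᵀ * R).trace = (Rᵀ * M).trace := by
    rw [← trace_transpose, transpose_mul, transpose_transpose]
  rw [h1, hR, trace_add, trace_sub, trace_sub, h2]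
  ring

lemma trace_polarFactor_sub_le {M R : Matrix m m ℝ} (hM : M.det ≠ 0) (hR : Rᵀ * R = 1) :
    ((polarFactor M - M)ᵀ * (polarFactor M - M)).trace ≤ ((R - M)ᵀ * (R - M)).trace := by
  have hQ := polarFactor_transpose_mul_self hM
  have hW : (Rᵀ * polarFactor M)ᵀ * (Rᵀ * polarFactor M) = 1 := by
    rw [transpose_mul, transpose_transpose, Matrix.mul_assoc, ← Matrix.mul_assoc R,
      mul_eq_one_comm.mp hR, Matrix.one_mul, hQ]
  have h := (posSemidef_sqrt (Mᵀ * M)).trace_mul_le_trace hW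
  have hQM : (polarFactor M)ᵀ * M = CFC.sqrt (Mᵀ * M) := by
    calc (polarFactor M)ᵀ * M = (polarFactor M)ᵀ * (polarFactor M * CFC.sqrt (Mᵀ * M)) := by
          rw [polarFactor_mul_sqrt hM]
      _ = CFC.sqrt (Mᵀ * M) := by rw [← Matrix.mul_assoc, hQ, Matrix.one_mul]
  rw [Matrix.mul_assoc, polarFactor_mul_sqrt hM] at h
  rw [trace_transpose_mul_self_orthogonal_sub hQ, trace_transpose_mul_self_orthogonal_sub hR, hQM]
  linarith

end Matrix

lemma frobNorm_eq_sqrt_trace {n : ℕ} (X : Matrix (Fin n) (Fin n) ℝ) :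
    frobNorm X = Real.sqrt (Xᵀ * X).trace := by
  rw [frobNorm, Finset.sum_comm]
  simp [Matrix.trace, Matrix.mul_apply, sq]

/-- **Smoothness of symmetric orthogonalization.** There is a map `f` on real
`n×n` matrices (viewed as elements of the pi type `Fin n → Fin n → ℝ`) that is
`C^∞` on the open set of invertible matrices, and such that whenever
`det M ≠ 0`, `f M` is orthogonal and is a Frobenius-nearest orthogonal matrix
to `M`. -/
theorem svd_orthogonalization_smooth (n : ℕ) (hn : 0 < n) :
    ∃ f : (Fin n → Fin n → ℝ) → (Fin n → Fin n → ℝ),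
      ContDiffOn ℝ (⊤ : ℕ∞) f {M : Fin n → Fin n → ℝ | (Matrix.of M).det ≠ 0} ∧
      ∀ M : Fin n → Fin n → ℝ, (Matrix.of M).det ≠ 0 →
        (Matrix.of (f M))ᵀ * Matrix.of (f M) = 1 ∧
        ∀ R : Matrix (Fin n) (Fin n) ℝ, Rᵀ * R = 1 →
          frobNorm (Matrix.of (f M) - Matrix.of M) ≤ frobNorm (R - Matrix.of M) := by
  let e : (Fin n → Fin n → ℝ) ≃L[ℝ] Matrix (Fin n) (Fin n) ℝ :=
    (Matrix.ofLinearEquiv ℝ).toContinuousLinearEquiv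
  refine ⟨fun M => e.symm (Matrix.polarFactor (e M)), fun M hM => ?_, fun M hM =>
    ⟨Matrix.polarFactor_transpose_mul_self hM, fun R hR => ?_⟩⟩
  · have hF : ContDiffAt ℝ (⊤ : ℕ∞) Matrix.polarFactor (e M) := Matrix.contDiffAt_polarFactor hM
    exact (e.symm.contDiff.contDiffAt.comp M
      (hF.comp M e.contDiff.contDiffAt)).contDiffWithinAt
  · rw [frobNorm_eq_sqrt_trace, frobNorm_eq_sqrt_trace]
    exact Real.sqrt_le_sqrt (Matrix.trace_polarFactor_sub_le hM hR)
end

section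
/- Let n be a positive integer, M a real n×n matrix, and Q an orthogonal n×n matrix such that ‖M − Q‖_F ≤ ‖M − R‖_F for every orthogonal n×n matrix R. Then Mᵀ Q is symmetric, i.e. Mᵀ Q = Qᵀ M. (First-order optimality condition for the orthogonal Procrustes problem.) -/
open Matrix

theorem frobNorm_sq {n : ℕ} (A : Matrix (Fin n) (Fin n) ℝ) :
    frobNorm A ^ 2 = (Aᵀ * A).trace := by
  rw [frobNorm, Real.sq_sqrt (by positivity), Finset.sum_comm]
  simp [Matrix.trace, Matrix.mul_apply, sq]

theorem frobNorm_sub_sq_of_orthogonal {n : ℕ} (M R : Matrix (Fin n) (Fin n) ℝ)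
    (hR : Rᵀ * R = 1) :
    frobNorm (M - R) ^ 2 = (Mᵀ * M).trace + n - 2 * (Mᵀ * R).trace := by
  have h : (Rᵀ * M).trace = (Mᵀ * R).trace := by
    rw [← Matrix.trace_transpose, Matrix.transpose_mul, Matrix.transpose_transpose]
  simp only [frobNorm_sq, Matrix.transpose_sub, Matrix.sub_mul, Matrix.mul_sub,
    Matrix.trace_sub, hR, h, Matrix.trace_one, Fintype.card_fin]
  ring

/-- The rotation by the angle with cosine `c` and sine `s` in the `(i, j)` coordinate plane. -/
noncomputable def planeRotation {n : ℕ} (i j : Fin n) (c s : ℝ) : Matrix (Fin n) (Fin n) ℝ :=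
  1 + (c - 1) • (single i i 1 + single j j 1) + s • (single i j 1 - single j i 1)

theorem planeRotation_orthogonal {n : ℕ} {i j : Fin n} (hij : i ≠ j) {c s : ℝ}
    (hcs : c ^ 2 + s ^ 2 = 1) :
    (planeRotation i j c s)ᵀ * planeRotation i j c s = 1 := by
  set P : Matrix (Fin n) (Fin n) ℝ := single i i 1 + single j j 1 with hP
  set K : Matrix (Fin n) (Fin n) ℝ := single i j 1 - single j i 1 with hK
  have hPt : Pᵀ = P := by simp [hP]
  have hKt : Kᵀ = -K := by simp [hK]
  have hPP : P * P = P := by simp [hP, add_mul, mul_add, hij, hij.symm]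
  have hKK : K * K = -P := by
    simp [hP, hK, sub_mul, mul_sub, hij, hij.symm]
    abel
  have hPK : P * K = K := by
    simp [hP, hK, add_mul, mul_sub, hij, hij.symm]
  have hKP : K * P = K := by
    simp [hP, hK, sub_mul, mul_add, hij, hij.symm]
    abel
  have hG : planeRotation i j c s = 1 + (c - 1) • P + s • K := rfl
  rw [hG]
  simp only [transpose_add, transpose_smul, transpose_one, hPt, hKt, add_mul, mul_add,
    smul_mul_assoc, mul_smul_comm, neg_mul, smul_neg, hPP, hKK, hPK, hKP, one_mul, mul_one]
  linear_combination (norm := module) hcs • P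

theorem trace_mul_planeRotation {n : ℕ} (A : Matrix (Fin n) (Fin n) ℝ) (i j : Fin n) (c s : ℝ) :
    (A * planeRotation i j c s).trace =
      A.trace + (c - 1) * (A i i + A j j) + s * (A j i - A i j) := by
  simp [planeRotation, mul_add, mul_sub, Matrix.trace_mul_single]
  ring

theorem eq_zero_of_forall_circle_le {p q : ℝ}
    (h : ∀ c s : ℝ, c ^ 2 + s ^ 2 = 1 → (c - 1) * p + s * q ≤ 0) : q = 0 := by
  by_contra hq
  set k := |p| + 1 with hk
  have hk0 : 0 < k := by positivity
  have hd : 0 < k ^ 2 + q ^ 2 := by positivity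
  have key := h ((k ^ 2 - q ^ 2) / (k ^ 2 + q ^ 2)) (2 * k * q / (k ^ 2 + q ^ 2))
    (by field_simp; ring)
  have e : ((k ^ 2 - q ^ 2) / (k ^ 2 + q ^ 2) - 1) * p + 2 * k * q / (k ^ 2 + q ^ 2) * q =
      2 * q ^ 2 * (k - p) / (k ^ 2 + q ^ 2) := by
    field_simp
    ring
  have hkp : 0 < k - p := by linarith [le_abs_self p]
  have : 0 < 2 * q ^ 2 * (k - p) / (k ^ 2 + q ^ 2) := by positivity
  linarith

/-- A square matrix whose trace does not increase under right multiplication by an orthogonal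
matrix is symmetric. -/
theorem isSymm_of_forall_trace_mul_le {n : ℕ} {A : Matrix (Fin n) (Fin n) ℝ}
    (h : ∀ S : Matrix (Fin n) (Fin n) ℝ, Sᵀ * S = 1 → (A * S).trace ≤ A.trace) : A.IsSymm := by
  refine Matrix.IsSymm.ext fun i j => ?_
  rcases eq_or_ne i j with rfl | hij
  · rfl
  refine sub_eq_zero.mp (eq_zero_of_forall_circle_le (p := A i i + A j j) fun c s hcs => ?_)
  have := h _ (planeRotation_orthogonal hij hcs)
  rw [trace_mul_planeRotation] at this
  linarith

/-- **First-order optimality for the orthogonal Procrustes problem.** If `Q`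
is orthogonal and minimizes the Frobenius distance to `M` over the orthogonal
group, then `Mᵀ Q` is symmetric: `Mᵀ Q = Qᵀ M`. -/
theorem procrustes_first_order_optimality (n : ℕ) (hn : 0 < n)
    (M Q : Matrix (Fin n) (Fin n) ℝ) (hQ : Qᵀ * Q = 1)
    (hmin : ∀ R : Matrix (Fin n) (Fin n) ℝ, Rᵀ * R = 1 →
      frobNorm (M - Q) ≤ frobNorm (M - R)) :
    Mᵀ * Q = Qᵀ * M := by
  have hsymm : (Mᵀ * Q).IsSymm := isSymm_of_forall_trace_mul_le fun S hS => by
    have hQS : (Q * S)ᵀ * (Q * S) = 1 := by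
      rw [transpose_mul, Matrix.mul_assoc, ← Matrix.mul_assoc Qᵀ, hQ, Matrix.one_mul, hS]
    have hle : frobNorm (M - Q) ^ 2 ≤ frobNorm (M - Q * S) ^ 2 :=
      pow_le_pow_left₀ (Real.sqrt_nonneg _) (hmin _ hQS) 2
    rw [frobNorm_sub_sq_of_orthogonal M Q hQ, frobNorm_sub_sq_of_orthogonal M _ hQS] at hle
    rw [Matrix.mul_assoc]
    linarith
  simpa using hsymm.eq.symm
end
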